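/- arXiv:2104.11046 — 2 statements merged into one kernel-verified Lean document; each statement's English description precedes it below -/
import Mathlib

section
/- Let A ⊆ ℝ³ have covering radius at most R. Then for every integer k ≥ 0, every point y ∈ ℝ³ is contained in at least k+1 closed balls of radius t centered at points of A, whenever t ≥ R·(k+1)^{1/3} + R. -/
open MeasureTheory Set Metric Pointwise

noncomputable section

/-- 3-dimensional Euclidean space. -/
abbrev E3 := EuclideanSpace ℝ (Fin 3)

/-- The lattice generated by the vectors `b 0, b 1, b 2`. -/
def lat (b : Fin 3 → E3) : Set E3 := {x | ∃ n : Fin 3 → ℤ, x = ∑ i, (n i : ℝ) • b i}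

/-- The unit cell spanned by the vectors `b 0, b 1, b 2`. -/
def cell (b : Fin 3 → E3) : Set E3 :=
  {x | ∃ c : Fin 3 → ℝ, (∀ i, 0 ≤ c i ∧ c i < 1) ∧ x = ∑ i, c i • b i}

/-- The `k`-fold cover: points lying in at least `k` closed balls of radius `t`
centered at points of `A`. -/
def coverGE (A : Set E3) (t : ℝ) (k : ℕ) : Set E3 :=
  {x | ∃ F : Finset E3, F.card = k ∧ ↑F ⊆ A ∧ ∀ a ∈ F, dist x a ≤ t}

/-- Points lying in exactly `k` closed balls of radius `t` centered at points of `A`. -/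
def coverEQ (A : Set E3) (t : ℝ) (k : ℕ) : Set E3 :=
  {x | ∃ F : Finset E3, ↑F = {a ∈ A | dist x a ≤ t} ∧ F.card = k}

/-- The `k`-th Dirichlet–Voronoi domain of `a` in `A` (with `D_0 = ∅`). -/
def DV (A : Set E3) (a : E3) : ℕ → Set E3
  | 0 => ∅
  | (k+1) => {x | ({b ∈ A | dist x b < dist x a}).ncard ≤ k}

/-- The `k`-th Brillouin zone of `a` in `A`. -/
def BZ (A : Set E3) (a : E3) (k : ℕ) : Set E3 := DV A a k \ DV A a (k-1)

/-- If a ball of radius `r` in a `d`-dimensional space is covered by finitely many closed balls of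
radius `R`, then at least `(r / R) ^ d` of them are needed. -/
theorem pow_finrank_le_card_mul_of_closedBall_subset {E : Type*} [NormedAddCommGroup E]
    [NormedSpace ℝ E] [FiniteDimensional ℝ E] {y : E} {r R : ℝ} (hr : 0 ≤ r) (hR : 0 ≤ R)
    {F : Finset E} (hF : closedBall y r ⊆ ⋃ a ∈ F, closedBall a R) :
    r ^ Module.finrank ℝ E ≤ F.card * R ^ Module.finrank ℝ E := by
  borelize E
  let μ : Measure E := Measure.addHaar
  have hμ : μ (closedBall y r) ≤ ∑ a ∈ F, μ (closedBall a R) :=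
    (measure_mono hF).trans (measure_biUnion_finset_le F _)
  simp only [Measure.addHaar_closedBall μ _ hr, Measure.addHaar_closedBall μ _ hR,
    Finset.sum_const, nsmul_eq_mul, ← mul_assoc] at hμ
  have h := (ENNReal.mul_le_mul_iff_left (measure_ball_pos μ 0 one_pos).ne'
    measure_ball_lt_top.ne).1 hμ
  rw [← ENNReal.ofReal_natCast, ← ENNReal.ofReal_mul (Nat.cast_nonneg _)] at h
  exact (ENNReal.ofReal_le_ofReal_iff (by positivity)).1 h

theorem mem_at_least_kplus1_balls (A : Set E3) (R : ℝ) (hR : 0 < R)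
    (hcover : ∀ x : E3, ∃ a ∈ A, dist x a ≤ R)
    (k : ℕ) (y : E3) (t : ℝ)
    (ht : R * ((k : ℝ) + 1) ^ ((1 : ℝ) / 3) + R ≤ t) :
    ∃ F : Finset E3, F.card = k + 1 ∧ ↑F ⊆ A ∧ ∀ a ∈ F, dist y a ≤ t := by
  have hk : (0 : ℝ) ≤ (k : ℝ) + 1 := by positivity
  rcases {a ∈ A | dist y a ≤ t}.finite_or_infinite with hfin | hinf
  · have hsub : closedBall y (R * ((k : ℝ) + 1) ^ ((1 : ℝ) / 3)) ⊆
        ⋃ a ∈ hfin.toFinset, closedBall a R := by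
      intro x hx
      obtain ⟨a, haA, hxa⟩ := hcover x
      have hya : dist y a ≤ t :=
        (dist_triangle_left y a x).trans ((add_le_add hx hxa).trans ht)
      exact mem_biUnion (by simpa using ⟨haA, hya⟩) hxa
    have h := pow_finrank_le_card_mul_of_closedBall_subset (by positivity) hR.le hsub
    have hroot : (((k : ℝ) + 1) ^ ((1 : ℝ) / 3)) ^ 3 = (k : ℝ) + 1 := by
      rw [← Real.rpow_natCast, ← Real.rpow_mul hk]
      norm_num
    rw [finrank_euclideanSpace_fin, mul_pow, hroot, mul_comm] at h
    have hcard : k + 1 ≤ hfin.toFinset.card := by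
      exact_mod_cast le_of_mul_le_mul_right h (pow_pos hR 3)
    obtain ⟨F, hF, hFcard⟩ := Finset.exists_subset_card_eq hcard
    have hmem : ∀ a ∈ F, a ∈ A ∧ dist y a ≤ t := fun a ha => by simpa using hF ha
    exact ⟨F, hFcard, fun a ha => (hmem a ha).1, fun a ha => (hmem a ha).2⟩
  · obtain ⟨F, hF, hFcard⟩ := hinf.exists_subset_card_eq (k + 1)
    exact ⟨F, hFcard, fun a ha => (hF ha).1, fun a ha => (hF ha).2⟩
end
end

section
/- Let A, Q be periodic point sets in ℝ³, both with packing radius at least r > 0 and covering radius at most R < ∞, and suppose the bottleneck distance δ between A and Q satisfies δ < r. Then for every k ≥ 0, (k+1)^{−2/3} · ‖ψ_k^A − ψ_k^Q‖_∞ ≤ (12R²/r³)·δ + (1/(4r³))·δ³ ≤ (13R²/r³)·δ, where ψ_k^S(t) is the probability that a uniformly random point in a unit cell of S lies in exactly k closed balls of radius t centered at points of S. -/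
open MeasureTheory Set Metric Pointwise

noncomputable section

/-- The `k`-th density function of a periodic set with unit cell `cell b`:
the probability that a uniformly random point of the unit cell lies in exactly `k`
closed balls of radius `t` centered at points of `S`. -/
def psi (b : Fin 3 → E3) (S : Set E3) (k : ℕ) (t : ℝ) : ℝ :=
  (volume (cell b ∩ coverEQ S t k)).toReal / (volume (cell b)).toReal

lemma cell_eq (b : Module.Basis (Fin 3) ℝ E3) : cell b = ZSpan.fundamentalDomain b := by
  ext x
  rw [ZSpan.mem_fundamentalDomain]
  constructor
  · rintro ⟨c, hc, rfl⟩ i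
    have : b.repr (∑ i, c i • b i) i = c i := by
      rw [← Module.Basis.equivFun_apply, Module.Basis.equivFun_apply]
      exact congrFun (b.repr_sum_self c) i
    rw [this]
    exact ⟨(hc i).1, (hc i).2⟩
  · intro h
    exact ⟨fun i => b.repr x i, fun i => ⟨(h i).1, (h i).2⟩, (b.sum_repr x).symm⟩

lemma lat_eq (b : Fin 3 → E3) : lat b = (Submodule.span ℤ (range b) : Set E3) := by
  ext x
  simp only [lat, mem_ofPred_eq, SetLike.mem_coe, Submodule.mem_span_range_iff_exists_fun]
  constructor
  · rintro ⟨n, rfl⟩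
    exact ⟨n, Finset.sum_congr rfl fun i _ => (Int.cast_smul_eq_zsmul ℝ _ _).symm⟩
  · rintro ⟨n, rfl⟩
    exact ⟨n, Finset.sum_congr rfl fun i _ => (Int.cast_smul_eq_zsmul ℝ _ _).symm⟩

lemma countable_lat (b : Fin 3 → E3) : (lat b).Countable :=
  (countable_range fun n : Fin 3 → ℤ => ∑ i, (n i : ℝ) • b i).mono
    (by rintro _ ⟨n, rfl⟩; exact ⟨n, rfl⟩)

lemma measurableSet_coverEQ {A : Set E3} (hA : A.Countable) (t : ℝ) (k : ℕ) :
    MeasurableSet (coverEQ A t k) := by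
  have : coverEQ A t k = ⋃ F ∈ {F : Finset E3 | ↑F ⊆ A ∧ F.card = k},
      ⋂ a ∈ A, {x | dist x a ≤ t ↔ a ∈ F} := by
    ext x
    simp only [coverEQ, mem_ofPred_eq, mem_iUnion, mem_iInter, exists_prop]
    constructor
    · rintro ⟨F, hF, hk⟩
      refine ⟨F, ⟨hF ▸ fun a ha => ha.1, hk⟩, fun a ha => ?_⟩
      rw [← Finset.mem_coe, hF]
      exact ⟨fun h => ⟨ha, h⟩, fun h => h.2⟩
    · rintro ⟨F, ⟨hFA, hk⟩, h⟩
      refine ⟨F, ?_, hk⟩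
      ext a
      exact ⟨fun ha => ⟨hFA ha, (h a (hFA ha)).2 ha⟩, fun ha => (h a ha.1).1 ha.2⟩
  rw [this]
  have hc : {F : Finset E3 | ↑F ⊆ A ∧ F.card = k}.Countable := by
    refine Set.Countable.mono (fun F hF => ?_)
      ((countable_ofPred_finite_subset hA).preimage Finset.coe_injective)
    exact ⟨F.finite_toSet, hF.1⟩
  refine MeasurableSet.biUnion hc fun F _ => ?_
  refine MeasurableSet.biInter hA fun a _ => ?_
  have hm : MeasurableSet {x : E3 | dist x a ≤ t} := measurableSet_closedBall
  by_cases ha : a ∈ F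
  · simpa [ha] using hm
  · simp only [ha, iff_false]
    exact hm.compl

lemma add_mem_coverEQ_iff {A : Set E3} {v : E3} (hv : ∀ a, a + v ∈ A ↔ a ∈ A) (t : ℝ) (k : ℕ)
    (x : E3) : x + v ∈ coverEQ A t k ↔ x ∈ coverEQ A t k := by
  have key : ∀ (w x : E3), (∀ a, a + w ∈ A ↔ a ∈ A) →
      x ∈ coverEQ A t k → x + w ∈ coverEQ A t k := by
    rintro w x hw ⟨F, hF, hk⟩
    refine ⟨F.map (addRightEmbedding w), ?_, by simpa using hk⟩
    ext y
    have hy : y - w ∈ (F : Set E3) ↔ y ∈ A ∧ dist (x + w) y ≤ t := by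
      rw [hF, mem_ofPred_eq, ← hw (y - w), sub_add_cancel, ← dist_add_right x (y - w) w,
        sub_add_cancel]
    rw [mem_ofPred_eq, ← hy]
    simp only [Finset.coe_map, addRightEmbedding_apply, mem_image]
    constructor
    · rintro ⟨z, hz, rfl⟩; simpa using hz
    · intro h; exact ⟨_, h, by simp⟩
  refine ⟨fun h => ?_, key v x hv⟩
  have := key (-v) (x + v) (fun a => by rw [← hv (a + -v)]; simp) h
  simpa using this

/-- The average of the volumes of an invariant set in the balls centered in a unit cell. -/
lemma lintegral_volume_inter_closedBall (b : Module.Basis (Fin 3) ℝ E3) {E : Set E3}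
    (hE : MeasurableSet E) (hinv : ∀ v ∈ lat b, ∀ x, x + v ∈ E ↔ x ∈ E) (L : ℝ) :
    ∫⁻ y in cell b, volume (E ∩ closedBall y L) =
      volume (cell b ∩ E) * volume (closedBall (0 : E3) L) := by
  have hfd := ZSpan.isAddFundamentalDomain b (volume : Measure E3)
  have : VAddInvariantMeasure (Submodule.span ℤ (range b)) E3 volume :=
    inferInstanceAs <| VAddInvariantMeasure (Submodule.span ℤ (range b)).toAddSubgroup E3 volume
  have htr : ∀ z : E3, volume ((fun y => y + z) ⁻¹' E ∩ cell b) = volume (cell b ∩ E) := by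
    intro z
    have h1 : ((fun y => y + z) ⁻¹' E ∩ cell b) =
        (fun y => y + z) ⁻¹' (E ∩ (z +ᵥ cell b)) := by
      ext y
      simp [Set.mem_vadd_set_iff_neg_vadd_mem, add_comm]
    rw [h1, measure_preimage_add_right, inter_comm (cell b), cell_eq]
    refine (hfd.vadd_of_comm z).measure_set_eq hfd hE fun g => ?_
    ext x
    have := hinv g (by rw [lat_eq]; exact g.2) x
    rw [← this, mem_preimage, add_comm]
    rfl
  have hP : MeasurableSet {p : E3 × E3 | p.1 + p.2 ∈ E} := measurable_add hE
  have h1 := Measure.prod_apply (μ := volume.restrict (cell b))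
    (ν := volume.restrict (closedBall (0 : E3) L)) hP
  rw [Measure.prod_apply_symm hP] at h1
  have h2 : ∀ y : E3, volume.restrict (closedBall (0 : E3) L)
      (Prod.mk y ⁻¹' {p : E3 × E3 | p.1 + p.2 ∈ E}) = volume (E ∩ closedBall y L) := by
    intro y
    rw [Measure.restrict_apply (hP.preimage measurable_prodMk_left),
      ← measure_preimage_add volume y (E ∩ closedBall y L)]
    congr 1
    ext z
    simp [dist_eq_norm]
  have h3 : ∀ z : E3, volume.restrict (cell b)
      ((fun y => (y, z)) ⁻¹' {p : E3 × E3 | p.1 + p.2 ∈ E}) = volume (cell b ∩ E) := by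
    intro z
    rw [Measure.restrict_apply (hP.preimage measurable_prodMk_right), ← htr z]
    rfl
  simp only [h2, h3] at h1
  rw [← h1]
  simp

lemma psi_bounds {b : Fin 3 → E3} (hb : LinearIndependent ℝ b) {A : Set E3}
    (hA : A.Countable) (hinv : ∀ v ∈ lat b, ∀ a, a + v ∈ A ↔ a ∈ A) (t : ℝ) (k : ℕ) :
    ∃ D : ℝ, 0 ≤ D ∧ ∀ L : ℝ,
      psi b A k t * volume.real (closedBall (0 : E3) L) ≤
        volume.real (coverEQ A t k ∩ closedBall 0 (L + D)) ∧
      volume.real (coverEQ A t k ∩ closedBall 0 L) ≤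
        psi b A k t * volume.real (closedBall (0 : E3) (L + D)) := by
  obtain ⟨B, rfl⟩ : ∃ B : Module.Basis (Fin 3) ℝ E3, ⇑B = b :=
    ⟨basisOfLinearIndependentOfCardEqFinrank hb (by simp), by simp⟩
  have hbd : Bornology.IsBounded (cell B) := cell_eq B ▸ ZSpan.fundamentalDomain_isBounded B
  have hm : MeasurableSet (cell B) := cell_eq B ▸ ZSpan.fundamentalDomain_measurableSet B
  have hc0 : volume (cell B) ≠ 0 := cell_eq B ▸ ZSpan.measure_fundamentalDomain_ne_zero B
  have hct : volume (cell B) ≠ ⊤ := hbd.measure_lt_top.ne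
  obtain ⟨D, hD0, hD⟩ : ∃ D : ℝ, 0 < D ∧ ∀ x ∈ cell B, ‖x‖ ≤ D := hbd.exists_pos_norm_le
  have hE := measurableSet_coverEQ hA t k
  have hint := lintegral_volume_inter_closedBall B hE
    fun v hv x => add_mem_coverEQ_iff (hinv v hv) t k x
  have hpos : 0 < (volume (cell B)).toReal := ENNReal.toReal_pos hc0 hct
  have hfin : ∀ L, volume (coverEQ A t k ∩ closedBall 0 L) ≠ ⊤ := fun L =>
    
    measure_ne_top_of_subset inter_subset_right measure_closedBall_lt_top.ne
  refine ⟨D, hD0.le, fun L => ⟨?_, ?_⟩⟩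
  · have h : volume (cell B ∩ coverEQ A t k) * volume (closedBall (0 : E3) L) ≤
        volume (coverEQ A t k ∩ closedBall 0 (L + D)) * volume (cell B) := by
      rw [← hint, ← setLIntegral_const]
      refine setLIntegral_mono' hm fun x hx => measure_mono (inter_subset_inter_right _ ?_)
      exact closedBall_subset_closedBall' (by simpa using hD x hx)
    have h' := ENNReal.toReal_mono (ENNReal.mul_ne_top (hfin _) hct) h
    rw [ENNReal.toReal_mul, ENNReal.toReal_mul] at h'
    rw [psi, div_mul_eq_mul_div, div_le_iff₀ hpos]
    exact h'
  · have h : volume (coverEQ A t k ∩ closedBall 0 L) * volume (cell B) ≤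
        volume (cell B ∩ coverEQ A t k) * volume (closedBall (0 : E3) (L + D)) := by
      rw [← hint, ← setLIntegral_const]
      refine setLIntegral_mono' hm fun x hx => measure_mono (inter_subset_inter_right _ ?_)
      exact closedBall_subset_closedBall' (by simpa using hD x hx)
    have h' := ENNReal.toReal_mono (ENNReal.mul_ne_top
      (measure_ne_top_of_subset inter_subset_left hct) measure_closedBall_lt_top.ne) h
    rw [ENNReal.toReal_mul, ENNReal.toReal_mul] at h'
    rw [psi, div_mul_eq_mul_div, le_div_iff₀ hpos]
    exact h'

lemma volume_real_closedBall (x : E3) {L : ℝ} (hL : 0 ≤ L) :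
    volume.real (closedBall x L) = L ^ 3 * volume.real (ball (0 : E3) 1) := by
  simpa using Measure.addHaar_real_closedBall (volume : Measure E3) x hL

lemma volume_real_unitBall_pos : 0 < volume.real (ball (0 : E3) 1) :=
  ENNReal.toReal_pos (measure_ball_pos _ _ one_pos).ne' measure_ball_lt_top.ne

lemma volume_real_symmDiff_closedBall_le {a b : E3} {δ t : ℝ} (hab : dist a b ≤ δ) (ht : 0 ≤ t) :
    volume.real (symmDiff (closedBall a t) (closedBall b t)) ≤
      (3 * t ^ 2 * δ + δ ^ 3 / 4) * volume.real (ball (0 : E3) 1) := by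
  have hδ : 0 ≤ δ := dist_nonneg.trans hab
  have hc := volume_real_unitBall_pos
  set m := midpoint ℝ a b
  have ha : dist a m ≤ δ / 2 := by
    rw [dist_left_midpoint]; norm_num; linarith
  have hb : dist b m ≤ δ / 2 := by
    rw [dist_right_midpoint]; norm_num; linarith
  have hsub : symmDiff (closedBall a t) (closedBall b t) ⊆
      closedBall m (t + δ / 2) \ closedBall m (t - δ / 2) := by
    rintro x (⟨h1, h2⟩ | ⟨h1, h2⟩) <;> simp only [mem_closedBall, not_le, mem_sdiff] at h1 h2 ⊢
    · exact ⟨by linarith [dist_triangle x a m],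
        by linarith [dist_triangle x m b, dist_comm m b]⟩
    · exact ⟨by linarith [dist_triangle x b m],
        by linarith [dist_triangle x m a, dist_comm m a]⟩
  refine (measureReal_mono hsub
    (measure_ne_top_of_subset sdiff_subset measure_closedBall_lt_top.ne)).trans ?_
  rcases le_total (δ / 2) t with h | h
  · rw [measureReal_sdiff (closedBall_subset_closedBall (by linarith)) measurableSet_closedBall
      measure_closedBall_lt_top.ne,
      volume_real_closedBall _ (by linarith), volume_real_closedBall _ (by linarith)]
    exact le_of_eq (by ring)
  · refine (measureReal_mono sdiff_subset measure_closedBall_lt_top.ne).trans ?_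
    rw [volume_real_closedBall _ (by linarith)]
    refine mul_le_mul_of_nonneg_right ?_ hc.le
    nlinarith [pow_nonneg (sub_nonneg.2 h) 3]

lemma card_mul_pow_le_of_packing {A : Set E3} {r ρ : ℝ} (hr : 0 < r) (hρ : 0 ≤ ρ)
    (hpack : ∀ a ∈ A, ∀ a' ∈ A, a ≠ a' → 2 * r ≤ dist a a') {T : Finset E3}
    (hT : ↑T ⊆ A ∩ closedBall 0 ρ) : T.card * r ^ 3 ≤ (ρ + r) ^ 3 := by
  have hc := volume_real_unitBall_pos
  have hdisj : (T : Set E3).PairwiseDisjoint fun a => ball a r := fun a ha b hb hab =>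
    ball_disjoint_ball (by linarith [hpack a (hT ha).1 b (hT hb).1 hab])
  have h1 := measureReal_biUnion_finset (μ := volume) hdisj (fun a _ => measurableSet_ball)
    (fun a _ => measure_ball_lt_top.ne)
  have h2 : volume.real (⋃ a ∈ T, ball a r) ≤ volume.real (closedBall (0 : E3) (ρ + r)) := by
    refine measureReal_mono (iUnion₂_subset fun a ha x hx => ?_) measure_closedBall_lt_top.ne
    have h3 : dist a 0 ≤ ρ := (hT ha).2
    rw [mem_ball] at hx
    rw [mem_closedBall]
    linarith [dist_triangle x a 0]
  have h4 : ∀ a : E3, volume.real (ball a r) = r ^ 3 * volume.real (ball (0 : E3) 1) := fun a => by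
    rw [← volume_real_closedBall a hr.le, Measure.addHaar_real_closedBall_eq_addHaar_real_ball]
  rw [h1, volume_real_closedBall _ (by linarith), Finset.sum_congr rfl fun a _ => h4 a,
    Finset.sum_const, nsmul_eq_mul, ← mul_assoc] at h2
  exact le_of_mul_le_mul_right h2 hc

lemma exists_finset_of_packing {A : Set E3} {r ρ : ℝ} (hr : 0 < r) (hρ : 0 ≤ ρ)
    (hpack : ∀ a ∈ A, ∀ a' ∈ A, a ≠ a' → 2 * r ≤ dist a a') :
    ∃ T : Finset E3, ↑T = A ∩ closedBall 0 ρ ∧ T.card * r ^ 3 ≤ (ρ + r) ^ 3 := by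
  have hfin : (A ∩ closedBall 0 ρ).Finite := by
    by_contra hinf
    obtain ⟨n, hn⟩ := exists_nat_gt ((ρ + r) ^ 3 / r ^ 3)
    obtain ⟨T, hT, hcard⟩ := Set.Infinite.exists_subset_card_eq hinf n
    have := card_mul_pow_le_of_packing hr hρ hpack hT
    rw [div_lt_iff₀ (by positivity), ← hcard] at hn
    linarith
  exact ⟨hfin.toFinset, hfin.coe_toFinset,
    card_mul_pow_le_of_packing hr hρ hpack hfin.coe_toFinset.subset⟩

lemma exists_mem_symmDiff_of_mem_coverEQ {A Q : Set E3} {γ : E3 → E3} (hγ : BijOn γ A Q)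
    {t : ℝ} {k : ℕ} {x : E3} (hxA : x ∈ coverEQ A t k) (hxQ : x ∉ coverEQ Q t k) :
    ∃ a ∈ A, x ∈ symmDiff (closedBall a t) (closedBall (γ a) t) := by
  classical
  by_contra! hno
  have hiff : ∀ a ∈ A, dist x a ≤ t ↔ dist x (γ a) ≤ t := fun a ha => by
    have := hno a ha
    rw [Set.mem_symmDiff, mem_closedBall, mem_closedBall] at this
    tauto
  obtain ⟨F, hF, hk⟩ := hxA
  refine hxQ ⟨F.image γ, ?_, ?_⟩
  · rw [Finset.coe_image, hF]
    ext q
    constructor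
    · rintro ⟨a, ⟨ha, hd⟩, rfl⟩
      exact ⟨hγ.mapsTo ha, (hiff a ha).1 hd⟩
    · rintro ⟨hq, hd⟩
      obtain ⟨a, ha, rfl⟩ := hγ.surjOn hq
      exact ⟨a, ⟨ha, (hiff a ha).2 hd⟩, rfl⟩
  · rw [Finset.card_image_of_injOn, hk]
    rw [hF]
    exact hγ.injOn.mono fun a ha => ha.1

lemma volume_real_coverEQ_inter_closedBall_le {A Q : Set E3} {γ : E3 → E3} (hγ : BijOn γ A Q)
    {r δ t L : ℝ} (hr : 0 < r) (hδ : 0 ≤ δ) (ht : 0 ≤ t) (hL : 0 ≤ L)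
    (hpack : ∀ a ∈ A, ∀ a' ∈ A, a ≠ a' → 2 * r ≤ dist a a')
    (hclose : ∀ a ∈ A, dist a (γ a) ≤ δ) (k : ℕ) :
    volume.real (coverEQ A t k ∩ closedBall 0 L) ≤
      volume.real (coverEQ Q t k ∩ closedBall 0 L) +
        (3 * t ^ 2 * δ + δ ^ 3 / 4) / r ^ 3 * (L + (t + δ + r)) ^ 3 *
          volume.real (ball (0 : E3) 1) := by
  have hc := volume_real_unitBall_pos
  obtain ⟨T, hT, hcard⟩ := exists_finset_of_packing (ρ := L + (t + δ)) hr (by positivity) hpack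
  have hsub : coverEQ A t k ∩ closedBall 0 L ⊆ (coverEQ Q t k ∩ closedBall 0 L) ∪
      ⋃ a ∈ T, symmDiff (closedBall a t) (closedBall (γ a) t) := by
    rintro x ⟨hxA, hxL⟩
    by_cases hxQ : x ∈ coverEQ Q t k
    · exact Or.inl ⟨hxQ, hxL⟩
    obtain ⟨a, ha, hx⟩ := exists_mem_symmDiff_of_mem_coverEQ hγ hxA hxQ
    refine Or.inr (mem_iUnion₂.2 ⟨a, ?_, hx⟩)
    rw [← Finset.mem_coe, hT]
    refine ⟨ha, ?_⟩
    have hd := hclose a ha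
    have hxa : dist x a ≤ t + δ := by
      rcases hx with ⟨h, -⟩ | ⟨h, -⟩ <;> rw [mem_closedBall] at h
      · linarith
      · linarith [dist_triangle x (γ a) a, dist_comm a (γ a)]
    rw [mem_closedBall] at hxL ⊢
    linarith [dist_triangle a x 0, dist_comm a x]
  have hsd : ∀ a, volume (symmDiff (closedBall a t) (closedBall (γ a) t)) ≠ ⊤ := fun a =>
    measure_ne_top_of_subset symmDiff_subset_union
      (measure_union_lt_top measure_closedBall_lt_top measure_closedBall_lt_top).ne
  have hTA : ∀ a ∈ T, a ∈ A := fun a ha => by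
    rw [← Finset.mem_coe, hT] at ha
    exact ha.1
  calc volume.real (coverEQ A t k ∩ closedBall 0 L)
      ≤ volume.real ((coverEQ Q t k ∩ closedBall 0 L) ∪
          ⋃ a ∈ T, symmDiff (closedBall a t) (closedBall (γ a) t)) :=
        measureReal_mono hsub (measure_union_lt_top
          ((measure_mono inter_subset_right).trans_lt measure_closedBall_lt_top)
          ((measure_biUnion_lt_top T.finite_toSet fun a _ => (hsd a).lt_top))).ne
    _ ≤ volume.real (coverEQ Q t k ∩ closedBall 0 L) +
          ∑ a ∈ T, volume.real (symmDiff (closedBall a t) (closedBall (γ a) t)) :=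
        (measureReal_union_le _ _).trans
          (add_le_add_right (measureReal_biUnion_finset_le _ _) _)
    _ ≤ _ := by
        gcongr
        calc ∑ a ∈ T, volume.real (symmDiff (closedBall a t) (closedBall (γ a) t))
            ≤ ∑ a ∈ T, (3 * t ^ 2 * δ + δ ^ 3 / 4) * volume.real (ball (0 : E3) 1) :=
              Finset.sum_le_sum fun a ha =>
                volume_real_symmDiff_closedBall_le (hclose a (hTA a ha)) ht
          _ = (3 * t ^ 2 * δ + δ ^ 3 / 4) / r ^ 3 * (T.card * r ^ 3) *
                volume.real (ball (0 : E3) 1) := by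
              rw [Finset.sum_const, nsmul_eq_mul]
              field_simp
          _ ≤ _ := by
              gcongr
              linarith [hcard]

lemma le_of_forall_mul_pow_le {x y z p q : ℝ}
    (h : ∀ L : ℝ, 0 < L → x * L ^ 3 ≤ y * (L + p) ^ 3 + z * (L + q) ^ 3) : x ≤ y + z := by
  have hlim : ∀ p : ℝ, Filter.Tendsto (fun L : ℝ => (1 + p / L) ^ 3) Filter.atTop (nhds 1) := by
    intro p
    have : Filter.Tendsto (fun L : ℝ => p / L) Filter.atTop (nhds 0) :=
      Filter.Tendsto.const_div_atTop Filter.tendsto_id p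
    simpa using (this.const_add 1).pow 3
  have := ((hlim p).const_mul y).add ((hlim q).const_mul z)
  rw [mul_one, mul_one] at this
  refine ge_of_tendsto this ?_
  filter_upwards [Filter.eventually_gt_atTop 0] with L hL
  have h1 := h L hL
  have h2 : ∀ p : ℝ, (1 + p / L) ^ 3 = (L + p) ^ 3 / L ^ 3 := fun p => by
    field_simp
  rw [h2, h2, ← mul_div_assoc, ← mul_div_assoc, ← add_div, le_div_iff₀ (by positivity)]
  exact h1

lemma countable_and_invariant_of_periodic {b : Fin 3 → E3} {M : Finset E3} {A : Set E3}
    (hA : A = ↑M + lat b) : A.Countable ∧ ∀ v ∈ lat b, ∀ a, a + v ∈ A ↔ a ∈ A := by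
  subst hA
  refine ⟨M.countable_toSet.image2 (countable_lat b) _, fun v hv a => ?_⟩
  rw [lat_eq] at hv ⊢
  constructor
  · rintro ⟨m, hm, l, hl, h⟩
    exact ⟨m, hm, l - v, sub_mem hl hv, by simp only at h ⊢; rw [← add_sub_assoc, h]; simp⟩
  · rintro ⟨m, hm, l, hl, rfl⟩
    exact ⟨m, hm, l + v, add_mem hl hv, by simp [add_assoc]⟩

lemma psi_sub_psi_le {bA bQ : Fin 3 → E3}
    (hbA : LinearIndependent ℝ bA) (hbQ : LinearIndependent ℝ bQ) {MA MQ : Finset E3}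
    {A Q : Set E3} (hA : A = ↑MA + lat bA) (hQ : Q = ↑MQ + lat bQ) {r δ t : ℝ} (hr : 0 < r)
    (hpack : ∀ a ∈ A, ∀ a' ∈ A, a ≠ a' → 2 * r ≤ dist a a')
    (hδ : 0 ≤ δ) {γ : E3 → E3} (hγ : BijOn γ A Q) (hclose : ∀ a ∈ A, dist a (γ a) ≤ δ)
    (ht : 0 ≤ t) (k : ℕ) :
    psi bA A k t - psi bQ Q k t ≤ (3 * t ^ 2 * δ + δ ^ 3 / 4) / r ^ 3 := by
  have hc := volume_real_unitBall_pos
  obtain ⟨hcA, hiA⟩ := countable_and_invariant_of_periodic hA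
  obtain ⟨hcQ, hiQ⟩ := countable_and_invariant_of_periodic hQ
  obtain ⟨D, hD, hDA⟩ := psi_bounds hbA hcA hiA t k
  obtain ⟨D', hD', hDQ⟩ := psi_bounds hbQ hcQ hiQ t k
  rw [sub_le_iff_le_add']
  refine le_of_forall_mul_pow_le (p := D + D') (q := D + (t + δ + r)) fun L hL => ?_
  have h1 := (hDA L).1
  have h2 := volume_real_coverEQ_inter_closedBall_le hγ hr hδ ht
    (by positivity : 0 ≤ L + D) hpack hclose k
  have h3 := (hDQ (L + D)).2
  rw [volume_real_closedBall _ (by positivity)] at h1 h3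
  refine le_of_mul_le_mul_right ?_ hc
  rw [← add_assoc, ← add_assoc L D (t + δ + r)]
  linarith

lemma coverEQ_eq_empty {A : Set E3} {R t : ℝ} {k : ℕ} (hR : 0 < R)
    (hcover : ∀ x : E3, ∃ a ∈ A, dist x a ≤ R)
    (ht : 2 * R * ((k : ℝ) + 1) ^ ((1 : ℝ) / 3) ≤ t) : coverEQ A t k = ∅ := by
  rw [eq_empty_iff_forall_notMem]
  rintro x ⟨F, hF, hk⟩
  have hc := volume_real_unitBall_pos
  set s := ((k : ℝ) + 1) ^ ((1 : ℝ) / 3) with hs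
  have hs3 : s ^ 3 = k + 1 := by
    rw [hs, ← Real.rpow_natCast, ← Real.rpow_mul (by positivity)]
    norm_num
  have hs1 : 1 ≤ s := Real.one_le_rpow (by linarith [k.cast_nonneg (α := ℝ)]) (by norm_num)
  have hRs : R * s ≤ t - R := by nlinarith
  have hsub : closedBall x (t - R) ⊆ ⋃ a ∈ F, closedBall a R := by
    intro y hy
    obtain ⟨a, ha, hya⟩ := hcover y
    refine mem_iUnion₂.2 ⟨a, ?_, hya⟩
    rw [← Finset.mem_coe, hF]
    rw [mem_closedBall] at hy
    exact ⟨ha, by linarith [dist_triangle x y a, dist_comm x y]⟩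
  have h1 : volume.real (closedBall x (t - R)) ≤ ∑ a ∈ F, volume.real (closedBall a R) :=
    (measureReal_mono hsub (measure_biUnion_lt_top F.finite_toSet
      fun a _ => measure_closedBall_lt_top).ne).trans (measureReal_biUnion_finset_le _ _)
  have hRs0 : 0 ≤ R * s := by positivity
  rw [volume_real_closedBall _ (hRs0.trans hRs),
    Finset.sum_congr rfl fun a _ => volume_real_closedBall a hR.le, Finset.sum_const,
    nsmul_eq_mul, hk, ← mul_assoc] at h1
  have h2 := le_of_mul_le_mul_right h1 hc
  have h3 : (R * s) ^ 3 ≤ (t - R) ^ 3 := pow_le_pow_left₀ hRs0 hRs 3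
  rw [mul_pow, hs3] at h3
  nlinarith [pow_pos hR 3]

lemma packing_le_covering {A : Set E3} {r R : ℝ} (hR : 0 < R)
    (hpack : ∀ a ∈ A, ∀ a' ∈ A, a ≠ a' → 2 * r ≤ dist a a')
    (hcover : ∀ x : E3, ∃ a ∈ A, dist x a ≤ R) : 2 * r ≤ 3 * R := by
  obtain ⟨a, ha, -⟩ := hcover 0
  obtain ⟨v, hv⟩ := exists_norm_eq E3 (by positivity : 0 ≤ 2 * R)
  obtain ⟨a', ha', h⟩ := hcover (a + v)
  have hd : dist (a + v) a = 2 * R := by rw [dist_eq_norm, add_sub_cancel_left, hv]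
  have hne : a ≠ a' := by
    rintro rfl
    linarith
  linarith [hpack a ha a' ha' hne, dist_triangle a (a + v) a', dist_comm (a + v) a]

theorem fingerprint_continuity (bA bQ : Fin 3 → E3)
    (hbA : LinearIndependent ℝ bA) (hbQ : LinearIndependent ℝ bQ)
    (MA MQ : Finset E3) (hMA : ↑MA ⊆ cell bA) (hMQ : ↑MQ ⊆ cell bQ)
    (A Q : Set E3) (hA : A = ↑MA + lat bA) (hQ : Q = ↑MQ + lat bQ)
    (r R : ℝ) (hr : 0 < r) (hR : 0 < R)
    (hpackA : ∀ a ∈ A, ∀ a' ∈ A, a ≠ a' → 2 * r ≤ dist a a')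
    (hpackQ : ∀ q ∈ Q, ∀ q' ∈ Q, q ≠ q' → 2 * r ≤ dist q q')
    (hcoverA : ∀ x : E3, ∃ a ∈ A, dist x a ≤ R)
    (hcoverQ : ∀ x : E3, ∃ q ∈ Q, dist x q ≤ R)
    (δ : ℝ) (hδ0 : 0 ≤ δ) (hδ : δ < r)
    (γ : E3 → E3) (hγ : Set.BijOn γ A Q) (hclose : ∀ a ∈ A, dist a (γ a) ≤ δ)
    (k : ℕ) (t : ℝ) (ht : 0 ≤ t) :
    ((k : ℝ) + 1) ^ (-(2 : ℝ) / 3) * |psi bA A k t - psi bQ Q k t| ≤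
        (12 * R ^ 2 / r ^ 3) * δ + δ ^ 3 / (4 * r ^ 3) ∧
      (12 * R ^ 2 / r ^ 3) * δ + δ ^ 3 / (4 * r ^ 3) ≤ (13 * R ^ 2 / r ^ 3) * δ := by
  have hk : (0 : ℝ) < (k : ℝ) + 1 := by positivity
  refine ⟨?_, ?_⟩
  · rcases le_total (2 * R * ((k : ℝ) + 1) ^ ((1 : ℝ) / 3)) t with hlarge | hsmall
    · have hψ : psi bA A k t - psi bQ Q k t = 0 := by
        simp [psi, coverEQ_eq_empty hR hcoverA hlarge, coverEQ_eq_empty hR hcoverQ hlarge]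
      rw [hψ, abs_zero, mul_zero]
      positivity
    have hclose' : ∀ q ∈ Q, dist q (Function.invFunOn γ A q) ≤ δ := fun q hq => by
      have h1 := hclose _ (Function.invFunOn_mem (hγ.surjOn hq))
      rwa [Function.invFunOn_eq (hγ.surjOn hq), dist_comm] at h1
    have hAQ := psi_sub_psi_le hbA hbQ hA hQ hr hpackA hδ0 hγ hclose ht k
    have hQA := psi_sub_psi_le hbQ hbA hQ hA hr hpackQ hδ0
      (hγ.symm hγ.invOn_invFunOn.symm) hclose' ht k
    have habs : |psi bA A k t - psi bQ Q k t| ≤ (3 * t ^ 2 * δ + δ ^ 3 / 4) / r ^ 3 :=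
      abs_le.2 ⟨by linarith, hAQ⟩
    set w := ((k : ℝ) + 1) ^ (-(2 : ℝ) / 3) with hw
    have hw0 : 0 < w := Real.rpow_pos_of_pos hk _
    have hw1 : w ≤ 1 := Real.rpow_le_one_of_one_le_of_nonpos
      (by linarith [k.cast_nonneg (α := ℝ)]) (by norm_num)
    have hws : w * (((k : ℝ) + 1) ^ ((1 : ℝ) / 3)) ^ 2 = 1 := by
      rw [hw, ← Real.rpow_natCast, ← Real.rpow_mul hk.le, ← Real.rpow_add hk]
      norm_num
    have hwt : w * t ^ 2 ≤ 4 * R ^ 2 := by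
      calc w * t ^ 2 ≤ w * (2 * R * ((k : ℝ) + 1) ^ ((1 : ℝ) / 3)) ^ 2 := by gcongr
        _ = 4 * R ^ 2 * (w * (((k : ℝ) + 1) ^ ((1 : ℝ) / 3)) ^ 2) := by ring
        _ = 4 * R ^ 2 := by rw [hws, mul_one]
    calc w * |psi bA A k t - psi bQ Q k t|
        ≤ w * ((3 * t ^ 2 * δ + δ ^ 3 / 4) / r ^ 3) := by gcongr
      _ = (3 * (w * t ^ 2) * δ + w * (δ ^ 3 / 4)) / r ^ 3 := by ring
      _ ≤ (3 * (4 * R ^ 2) * δ + 1 * (δ ^ 3 / 4)) / r ^ 3 := by gcongr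
      _ = (12 * R ^ 2 / r ^ 3) * δ + δ ^ 3 / (4 * r ^ 3) := by
        field_simp
        ring
  · have hrR := packing_le_covering hR hpackA hcoverA
    have hδR : δ ^ 2 ≤ 4 * R ^ 2 := by nlinarith
    calc (12 * R ^ 2 / r ^ 3) * δ + δ ^ 3 / (4 * r ^ 3)
        = (12 * R ^ 2 + δ ^ 2 / 4) / r ^ 3 * δ := by
          field_simp
      _ ≤ (13 * R ^ 2 / r ^ 3) * δ := by
          gcongr
          linarith
end
end
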